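/- Let e ≥ 10 be an integer. The defining toric ideal I_{S(e,1,3)} of the numerical semigroup S(e,1,3) inside R(e,1,3) = K[x_0, x_2, x_4, x_5, …, x_{e−1}] is generated, minimally, by the set G = J ∪ K ∪ L, where J = {x_i x_{j+1} − x_{i+1} x_j : i < j, i, j ∈ {4,…,e−2}} ∪ {x_0^2 x_i − x_{i+1} x_{e−1} : i ∈ {4,…,e−2}}, K = {x_0 x_{i+2} − x_2 x_i : i ∈ {2} ∪ {4,…,e−3}} ∪ {x_0^3 − x_2 x_{e−2}}, and L = {x_4 x_{4+i} − x_2 x_{6+i} : 0 ≤ i ≤ e−7} ∪ {x_0^2 x_2 − x_4 x_{e−2}}. -/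

import Mathlib

open MvPolynomial

/-- Index set of the polynomial ring `R(e,m,n)`: indices `i ∈ {0,…,e−1} \ {m,n}`. -/
abbrev SallyIdx (e m n : ℕ) : Type := {i : ℕ // i < e ∧ i ≠ m ∧ i ≠ n}

/-- The variable `x_i` of `R(e,m,n)` (and `0` for an invalid index). -/
noncomputable def sX (e m n : ℕ) (i : ℕ) : MvPolynomial (SallyIdx e m n) ℚ :=
  if h : i < e ∧ i ≠ m ∧ i ≠ n then MvPolynomial.X ⟨i, h⟩ else 0

/-- The defining toric ideal `I_{S(e,m,n)}`: the kernel of the `ℚ`-algebra homomorphism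
`R(e,m,n) → ℚ[t]` sending `x_i ↦ t^{e+i}`. -/
noncomputable def sallyIdeal (e m n : ℕ) : Ideal (MvPolynomial (SallyIdx e m n) ℚ) :=
  RingHom.ker (MvPolynomial.aeval
    (fun i : SallyIdx e m n => (Polynomial.X : Polynomial ℚ) ^ (e + i.1))).toRingHom

/-- The generating set `G = J ∪ K ∪ L` for `I_{S(e,1,3)}`. -/
noncomputable def genSet (e : ℕ) : Set (MvPolynomial (SallyIdx e 1 3) ℚ) :=
  -- J
  {p | ∃ i j : ℕ, 4 ≤ i ∧ i < j ∧ j ≤ e - 2 ∧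
      p = sX e 1 3 i * sX e 1 3 (j+1) - sX e 1 3 (i+1) * sX e 1 3 j} ∪
  {p | ∃ i : ℕ, 4 ≤ i ∧ i ≤ e - 2 ∧
      p = sX e 1 3 0 ^ 2 * sX e 1 3 i - sX e 1 3 (i+1) * sX e 1 3 (e-1)} ∪
  -- K
  {p | ∃ i : ℕ, (i = 2 ∨ (4 ≤ i ∧ i ≤ e - 3)) ∧
      p = sX e 1 3 0 * sX e 1 3 (i+2) - sX e 1 3 2 * sX e 1 3 i} ∪
  {sX e 1 3 0 ^ 3 - sX e 1 3 2 * sX e 1 3 (e-2)} ∪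
  -- L
  {p | ∃ i : ℕ, i ≤ e - 7 ∧
      p = sX e 1 3 4 * sX e 1 3 (4+i) - sX e 1 3 2 * sX e 1 3 (6+i)} ∪
  {sX e 1 3 0 ^ 2 * sX e 1 3 2 - sX e 1 3 4 * sX e 1 3 (e-2)}

/-- The relations among the images `y i` of the variables imposed by `genSet e`. -/
structure SallyRelations {A : Type*} [CommRing A] (e : ℕ) (y : ℕ → A) : Prop where
  minor : ∀ i j, 4 ≤ i → i < j → j ≤ e - 2 → y i * y (j + 1) = y (i + 1) * y j
  minor_last : ∀ i, 4 ≤ i → i ≤ e - 2 → y 0 ^ 2 * y i = y (i + 1) * y (e - 1)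
  shift_zero : ∀ i, (i = 2 ∨ (4 ≤ i ∧ i ≤ e - 3)) → y 0 * y (i + 2) = y 2 * y i
  cube : y 0 ^ 3 = y 2 * y (e - 2)
  shift_two : ∀ i, i ≤ e - 7 → y 4 * y (4 + i) = y 2 * y (6 + i)
  sq_mul : y 0 ^ 2 * y 2 = y 4 * y (e - 2)

/-- The monomial representing the element of the Apéry set in the residue class of `r`. -/
def aperyMonomial {A : Type*} [CommRing A] (e : ℕ) (y : ℕ → A) (r : ℕ) : A :=
  if r = 0 then 1 else if r = 1 then y 2 * y (e - 1) else
    if r = 3 then y 4 * y (e - 1) else y r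

/-- The element of the Apéry set of `S(e,1,3)` in the residue class of `r`. -/
def aperyDegree (e r : ℕ) : ℕ :=
  if r = 0 then 0 else if r = 1 ∨ r = 3 then 3 * e + r else e + r

/-- `z` is a power of `y 0` times an Apéry monomial, of total degree `d`. -/
def IsNormalForm {A : Type*} [CommRing A] (e : ℕ) (y : ℕ → A) (d : ℕ) (z : A) : Prop :=
  ∃ k r, r < e ∧ z = y 0 ^ k * aperyMonomial e y r ∧ d = k * e + aperyDegree e r

section NormalForm

variable {A : Type*} [CommRing A] {e : ℕ} {y : ℕ → A}

lemma aperyDegree_mod {r : ℕ} (hr : r < e) : aperyDegree e r % e = r := by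
  unfold aperyDegree
  split_ifs with h0 h1
  · simp [h0]
  · rw [Nat.mul_add_mod', Nat.mod_eq_of_lt hr]
  · rw [Nat.add_mod_left, Nat.mod_eq_of_lt hr]

lemma IsNormalForm.unique {d : ℕ} {z w : A} (hz : IsNormalForm e y d z)
    (hw : IsNormalForm e y d w) : z = w := by
  obtain ⟨k, r, hr, rfl, hd⟩ := hz
  obtain ⟨l, s, hs, rfl, hd'⟩ := hw
  have hmod : ∀ k r, r < e → (k * e + aperyDegree e r) % e = r := fun k r hr => by
    rw [Nat.mul_add_mod_self_right, aperyDegree_mod hr]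
  have hrs : r = s := by rw [← hmod k r hr, ← hd, hd', hmod l s hs]
  subst hrs
  have hkl : k * e = l * e := by omega
  rw [Nat.eq_of_mul_eq_mul_right (by omega) hkl]

lemma IsNormalForm.zero_pow_mul {d : ℕ} {z : A} (hz : IsNormalForm e y d z) (k : ℕ) {d' : ℕ}
    (hd' : d' = k * e + d) : IsNormalForm e y d' (y 0 ^ k * z) := by
  obtain ⟨l, r, hr, rfl, hd⟩ := hz
  exact ⟨k + l, r, hr, by ring, by rw [hd', hd]; ring⟩

lemma isNormalForm_one (he : 0 < e) : IsNormalForm e y 0 1 :=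
  ⟨0, 0, he, by simp [aperyMonomial], by simp [aperyDegree]⟩

lemma isNormalForm_var {b : ℕ} (hb : b < e) (h0 : b ≠ 0) (h1 : b ≠ 1) (h3 : b ≠ 3) :
    IsNormalForm e y (e + b) (y b) :=
  ⟨0, b, hb, by simp [aperyMonomial, h0, h1, h3], by simp [aperyDegree, h0, h1, h3]⟩

lemma isNormalForm_two_mul_last (he : 1 < e) :
    IsNormalForm e y (3 * e + 1) (y 2 * y (e - 1)) :=
  ⟨0, 1, he, by simp [aperyMonomial], by simp [aperyDegree]⟩

lemma isNormalForm_four_mul_last (he : 3 < e) :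
    IsNormalForm e y (3 * e + 3) (y 4 * y (e - 1)) :=
  ⟨0, 3, he, by simp [aperyMonomial], by simp [aperyDegree]⟩

lemma SallyRelations.isNormalForm_mul_of_le (H : SallyRelations e y) (he : 10 ≤ e) (a : ℕ) :
    ∀ b, 2 ≤ a → a ≤ b → b < e → a ≠ 3 → b ≠ 3 → IsNormalForm e y (2 * e + a + b) (y a * y b) := by
  induction a using Nat.strong_induction_on with
  | _ a ih =>
    intro b ha hab hb ha3 hb3
    have hvar : ∀ k c, c < e → c ≠ 0 → c ≠ 1 → c ≠ 3 → 2 * e + a + b = k * e + (e + c) →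
        IsNormalForm e y (2 * e + a + b) (y 0 ^ k * y c) := fun k c hc h0 h1 h3 hd =>
      (isNormalForm_var hc h0 h1 h3).zero_pow_mul k hd
    obtain rfl | rfl | ha5 : a = 2 ∨ a = 4 ∨ 5 ≤ a := by omega
    · obtain h | rfl | rfl : b ≤ e - 3 ∨ b = e - 2 ∨ b = e - 1 := by omega
      · rw [← H.shift_zero b (by omega), ← pow_one (y 0)]
        exact hvar 1 (b + 2) (by omega) (by omega) (by omega) (by omega) (by omega)
      · rw [← H.cube, ← mul_one (y 0 ^ 3)]
        exact (isNormalForm_one (by omega)).zero_pow_mul 3 (by omega)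
      · convert isNormalForm_two_mul_last (y := y) (show 1 < e by omega) using 1
        omega
    · obtain h | rfl | rfl : b ≤ e - 3 ∨ b = e - 2 ∨ b = e - 1 := by omega
      · obtain ⟨i, rfl⟩ := Nat.exists_eq_add_of_le hab
        rw [H.shift_two i (by omega)]
        convert ih 2 (by omega) (6 + i) (by omega) (by omega) (by omega) (by omega) (by omega)
          using 1
        omega
      · rw [← H.sq_mul]
        exact hvar 2 2 (by omega) (by omega) (by omega) (by omega) (by omega)
      · convert isNormalForm_four_mul_last (y := y) (show 3 < e by omega) using 1
        omega
    · obtain ⟨i, rfl⟩ : ∃ i, a = i + 1 := ⟨a - 1, by omega⟩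
      obtain h | rfl : b ≤ e - 2 ∨ b = e - 1 := by omega
      · rw [← H.minor i b (by omega) (by omega) h]
        convert ih i (by omega) (b + 1) (by omega) (by omega) (by omega) (by omega) (by omega)
          using 1
        omega
      · rw [← H.minor_last i (by omega) (by omega)]
        exact hvar 2 i (by omega) (by omega) (by omega) (by omega) (by omega)

lemma SallyRelations.isNormalForm_mul (H : SallyRelations e y) (he : 10 ≤ e) {a b d : ℕ}
    (ha : a < e ∧ a ≠ 1 ∧ a ≠ 3) (hb : b < e ∧ b ≠ 1 ∧ b ≠ 3) (hb0 : b ≠ 0)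
    (hd : d = 2 * e + a + b) : IsNormalForm e y d (y a * y b) := by
  subst hd
  rcases Nat.eq_zero_or_pos a with rfl | ha0
  · rw [← pow_one (y 0)]
    exact (isNormalForm_var hb.1 hb0 hb.2.1 hb.2.2).zero_pow_mul 1 (by omega)
  rcases le_total a b with h | h
  · exact H.isNormalForm_mul_of_le he a b (by omega) h (by omega) (by omega) (by omega)
  · convert H.isNormalForm_mul_of_le he b a (by omega) h (by omega) (by omega) (by omega) using 1
    · omega
    · ring

lemma SallyRelations.mul_last (H : SallyRelations e y) {c : ℕ} (hc : 5 ≤ c) (hce : c < e) :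
    y c * y (e - 1) = y 0 ^ 2 * y (c - 1) := by
  obtain ⟨i, rfl⟩ : ∃ i, c = i + 1 := ⟨c - 1, by omega⟩
  exact (H.minor_last i (by omega) (by omega)).symm

lemma SallyRelations.isNormalForm_mul_aperyMonomial (H : SallyRelations e y) (he : 10 ≤ e)
    {c r : ℕ} (hc : c < e ∧ c ≠ 1 ∧ c ≠ 3) (hr : r < e) :
    IsNormalForm e y (e + c + aperyDegree e r) (y c * aperyMonomial e y r) := by
  rcases Nat.eq_zero_or_pos c with rfl | hc0
  · exact ⟨1, r, hr, by rw [pow_one], by ring⟩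
  by_cases h0 : r = 0
  · simpa [aperyMonomial, aperyDegree, h0] using
      isNormalForm_var (y := y) hc.1 (by omega) hc.2.1 hc.2.2
  by_cases h1 : r = 1
  · simp only [aperyMonomial, aperyDegree, h1, one_ne_zero, if_false, if_true, true_or]
    obtain rfl | rfl | hc5 : c = 2 ∨ c = 4 ∨ 5 ≤ c := by omega
    · have hz : y 2 * (y 2 * y (e - 1)) = y 0 ^ 1 * (y 4 * y (e - 1)) := by
        linear_combination (-y (e - 1)) * H.shift_zero 2 (by omega)
      rw [hz]
      exact (isNormalForm_four_mul_last (by omega)).zero_pow_mul 1 (by omega)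
    · have hz : y 4 * (y 2 * y (e - 1)) = y 0 ^ 3 * y 5 := by
        linear_combination (-y (e - 1)) * H.shift_zero 4 (by omega) +
          y 0 * H.mul_last (c := 6) (by omega) (by omega)
      rw [hz]
      exact (isNormalForm_var (by omega) (by omega) (by omega) (by omega)).zero_pow_mul 3 (by omega)
    · have hz : y c * (y 2 * y (e - 1)) = y 0 ^ 2 * (y 2 * y (c - 1)) := by
        linear_combination y 2 * H.mul_last hc5 hc.1
      rw [hz]
      exact (H.isNormalForm_mul he (by omega) (by omega) (by omega) rfl).zero_pow_mul 2 (by omega)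
  by_cases h3 : r = 3
  · simp only [aperyMonomial, aperyDegree, h3, OfNat.ofNat_ne_zero, OfNat.ofNat_ne_one, if_false,
      if_true, or_true]
    obtain rfl | rfl | hc5 : c = 2 ∨ c = 4 ∨ 5 ≤ c := by omega
    · have hz : y 2 * (y 4 * y (e - 1)) = y 0 ^ 3 * y 5 := by
        linear_combination (-y (e - 1)) * H.shift_zero 4 (by omega) +
          y 0 * H.mul_last (c := 6) (by omega) (by omega)
      rw [hz]
      exact (isNormalForm_var (by omega) (by omega) (by omega) (by omega)).zero_pow_mul 3 (by omega)
    · have hz : y 4 * (y 4 * y (e - 1)) = y 0 ^ 2 * (y 2 * y 5) := by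
        linear_combination y (e - 1) * H.shift_two 0 (by omega) +
          y 2 * H.mul_last (c := 6) (by omega) (by omega)
      rw [hz]
      exact (H.isNormalForm_mul he (by omega) (by omega) (by omega) rfl).zero_pow_mul 2 (by omega)
    · have hz : y c * (y 4 * y (e - 1)) = y 0 ^ 2 * (y 4 * y (c - 1)) := by
        linear_combination y 4 * H.mul_last hc5 hc.1
      rw [hz]
      exact (H.isNormalForm_mul he (by omega) (by omega) (by omega) rfl).zero_pow_mul 2 (by omega)
  · simp only [aperyMonomial, aperyDegree, h0, h1, h3, if_false, or_self]
    exact H.isNormalForm_mul he hc ⟨hr, h1, h3⟩ h0 (by ring)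

lemma SallyRelations.isNormalForm_var_mul (H : SallyRelations e y) (he : 10 ≤ e) {c d : ℕ} {z : A}
    (hc : c < e ∧ c ≠ 1 ∧ c ≠ 3) (hz : IsNormalForm e y d z) :
    IsNormalForm e y (e + c + d) (y c * z) := by
  obtain ⟨k, r, hr, rfl, rfl⟩ := hz
  rw [mul_left_comm]
  exact (H.isNormalForm_mul_aperyMonomial he hc hr).zero_pow_mul k (by ring)

end NormalForm

lemma sX_of_mem {e m n i : ℕ} (h : i < e ∧ i ≠ m ∧ i ≠ n) : sX e m n i = X ⟨i, h⟩ :=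
  dif_pos h

lemma sallyRelations_mk (e : ℕ) :
    SallyRelations e (fun i => Ideal.Quotient.mk (Ideal.span (genSet e)) (sX e 1 3 i)) := by
  constructor
  all_goals intros
  all_goals
    simp only [← map_mul, ← map_pow]
    refine Ideal.Quotient.eq.2 (Ideal.subset_span ?_)
  · exact .inl <| .inl <| .inl <| .inl <| .inl ⟨_, _, ‹_›, ‹_›, ‹_›, rfl⟩
  · exact .inl <| .inl <| .inl <| .inl <| .inr ⟨_, ‹_›, ‹_›, rfl⟩
  · exact .inl <| .inl <| .inl <| .inr ⟨_, ‹_›, rfl⟩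
  · exact .inl <| .inl <| .inr rfl
  · exact .inl <| .inr ⟨_, ‹_›, rfl⟩
  · exact .inr rfl

lemma exists_isNormalForm_mk_monomial {e : ℕ} (he : 10 ≤ e) (m : SallyIdx e 1 3 →₀ ℕ) :
    ∃ d, aeval (fun i : SallyIdx e 1 3 => (Polynomial.X : Polynomial ℚ) ^ (e + i.1))
        (monomial m (1 : ℚ)) = Polynomial.X ^ d ∧
      IsNormalForm e (fun i => Ideal.Quotient.mk (Ideal.span (genSet e)) (sX e 1 3 i)) d
        (Ideal.Quotient.mk (Ideal.span (genSet e)) (monomial m 1)) := by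
  induction m using Finsupp.induction with
  | zero => exact ⟨0, by simp, by simpa using isNormalForm_one (by omega)⟩
  | single_add i k f _ _ ih =>
    clear * - ih he
    induction k with
    | zero => simpa using ih
    | succ k ihk =>
      obtain ⟨d, hd, hnf⟩ := ihk
      have hX : monomial (Finsupp.single i (k + 1) + f) (1 : ℚ) =
          sX e 1 3 i.1 * monomial (Finsupp.single i k + f) 1 := by
        rw [sX_of_mem i.2, X, monomial_mul, one_mul, ← add_assoc, ← Finsupp.single_add,
          add_comm 1 k]
      refine ⟨e + i.1 + d, ?_, ?_⟩
      · rw [hX, map_mul, hd, sX_of_mem i.2, aeval_X, ← pow_add]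
      · rw [hX, map_mul]
        exact (sallyRelations_mk e).isNormalForm_var_mul he i.2 hnf

lemma span_genSet_le (e : ℕ) (he : 10 ≤ e) : Ideal.span (genSet e) ≤ sallyIdeal e 1 3 := by
  rw [Ideal.span_le]
  have hX : ∀ i, i < e ∧ i ≠ 1 ∧ i ≠ 3 →
      aeval (fun i : SallyIdx e 1 3 => (Polynomial.X : Polynomial ℚ) ^ (e + i.1)) (sX e 1 3 i) =
        Polynomial.X ^ (e + i) := fun i hi => by rw [sX_of_mem hi, aeval_X]
  rintro p (((((⟨i, j, hi, hij, hj, rfl⟩ | ⟨i, hi, hj, rfl⟩) | ⟨i, hi, rfl⟩) | rfl) |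
    ⟨i, hi, rfl⟩) | rfl)
  all_goals
    simp only [sallyIdeal, SetLike.mem_coe, RingHom.mem_ker, AlgHom.toRingHom_eq_coe,
      RingHom.coe_coe, map_sub, map_mul, map_pow, sub_eq_zero]
    repeat rw [hX _ (by omega)]
    simp only [← pow_mul, ← pow_add]
    congr 1
    omega

lemma sallyIdeal_le_span_genSet (e : ℕ) (he : 10 ≤ e) :
    sallyIdeal e 1 3 ≤ Ideal.span (genSet e) := by
  intro p hp
  choose d hd hnf using exists_isNormalForm_mk_monomial (e := e) he
  classical
  let θ : Polynomial ℚ →ₗ[ℚ] MvPolynomial (SallyIdx e 1 3) ℚ ⧸ Ideal.span (genSet e) :=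
    (Polynomial.basisMonomials ℚ).constr ℚ fun k =>
      if h : ∃ m, d m = k then Ideal.Quotient.mk _ (monomial h.choose 1) else 0
  have hθ : ∀ m, θ (Polynomial.X ^ d m) =
      Ideal.Quotient.mk (Ideal.span (genSet e)) (monomial m 1) := fun m => by
    have h : ∃ m', d m' = d m := ⟨m, rfl⟩
    have hb := (Polynomial.basisMonomials ℚ).constr_basis ℚ (fun k =>
      if h : ∃ m, d m = k then Ideal.Quotient.mk (Ideal.span (genSet e)) (monomial h.choose 1)
      else 0) (d m)
    simp only [Polynomial.coe_basisMonomials, Polynomial.monomial_one_right_eq_X_pow] at hb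
    rw [dif_pos h] at hb
    refine hb.trans (IsNormalForm.unique (hnf h.choose) ?_)
    rw [h.choose_spec]
    exact hnf m
  have hcomp : θ ∘ₗ (aeval fun i : SallyIdx e 1 3 =>
      (Polynomial.X : Polynomial ℚ) ^ (e + i.1)).toLinearMap =
      (Ideal.Quotient.mkₐ ℚ (Ideal.span (genSet e))).toLinearMap := by
    refine (basisMonomials (SallyIdx e 1 3) ℚ).ext fun m => ?_
    simp [hd, hθ]
  have hp' : aeval (fun i : SallyIdx e 1 3 => (Polynomial.X : Polynomial ℚ) ^ (e + i.1)) p = 0 := hp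
  have := LinearMap.congr_fun hcomp p
  simp only [LinearMap.comp_apply, AlgHom.toLinearMap_apply, hp', map_zero,
    Ideal.Quotient.mkₐ_eq_mk] at this
  exact Ideal.Quotient.eq_zero_iff_mem.1 this.symm

section Minimality

open Classical in
/-- The sum of the coefficients of the quadratic monomials satisfying `Q`. -/
noncomputable def quadraticCoeffSum {σ : Type*} (Q : (σ →₀ ℕ) → Prop) :
    MvPolynomial σ ℚ →ₗ[ℚ] ℚ :=
  (basisMonomials σ ℚ).constr ℚ fun m => if m.degree = 2 ∧ Q m then 1 else 0

open Classical in
lemma quadraticCoeffSum_monomial {σ : Type*} (Q : (σ →₀ ℕ) → Prop) (m : σ →₀ ℕ) :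
    quadraticCoeffSum Q (monomial m 1) = if m.degree = 2 ∧ Q m then 1 else 0 := by
  simpa only [quadraticCoeffSum, coe_basisMonomials] using (basisMonomials σ ℚ).constr_basis ℚ
    (fun m => if m.degree = 2 ∧ Q m then (1 : ℚ) else 0) m

lemma quadraticCoeffSum_mul_monomial {σ : Type*} (Q : (σ →₀ ℕ) → Prop) {u : σ →₀ ℕ}
    (hu : 2 ≤ u.degree) (q : MvPolynomial σ ℚ) :
    quadraticCoeffSum Q (q * monomial u 1) =
      constantCoeff q * quadraticCoeffSum Q (monomial u 1) := by
  classical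
  induction q using MvPolynomial.induction_on' with
  | monomial m c =>
    rw [monomial_mul, mul_one, ← mul_one c, ← smul_eq_mul, ← smul_monomial, map_smul,
      quadraticCoeffSum_monomial, quadraticCoeffSum_monomial, constantCoeff_eq]
    by_cases hm : m = 0
    · simp [hm]
    · have : m.degree ≠ 0 := by simpa [Finsupp.degree_eq_zero_iff] using hm
      rw [if_neg (by rw [map_add]; omega), coeff_monomial, if_neg hm]
      simp
  | add p q hp hq => rw [add_mul, map_add, hp, hq, map_add, add_mul]

/-- The sum of the coefficients of the monomials `x_i x_j` with `i + j = s` and `i, j ≥ a`. -/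
noncomputable def tailCoeffSum (e s a : ℕ) : MvPolynomial (SallyIdx e 1 3) ℚ →ₗ[ℚ] ℚ :=
  quadraticCoeffSum fun m => m.sum (fun i k => k * i.1) = s ∧ ∀ i ∈ m.support, a ≤ i.1

lemma tailCoeffSum_mul_pair {e s a i j : ℕ} (hi : i < e ∧ i ≠ 1 ∧ i ≠ 3)
    (hj : j < e ∧ j ≠ 1 ∧ j ≠ 3) (q : MvPolynomial (SallyIdx e 1 3) ℚ) :
    tailCoeffSum e s a (q * (sX e 1 3 i * sX e 1 3 j)) =
      if i + j = s ∧ a ≤ i ∧ a ≤ j then constantCoeff q else 0 := by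
  classical
  have hX : sX e 1 3 i * sX e 1 3 j =
      monomial (Finsupp.single ⟨i, hi⟩ 1 + Finsupp.single ⟨j, hj⟩ 1) 1 := by
    rw [sX_of_mem hi, sX_of_mem hj, X, X, monomial_mul, one_mul]
  rw [hX, tailCoeffSum, quadraticCoeffSum_mul_monomial _ (by simp), quadraticCoeffSum_monomial]
  have hs : (Finsupp.single (⟨i, hi⟩ : SallyIdx e 1 3) 1 +
      Finsupp.single (⟨j, hj⟩ : SallyIdx e 1 3) 1).sum
      (fun i k => k * i.1) = i + j := by
    rw [Finsupp.sum_add_index' (by simp) (by intros; ring)]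
    simp
  have hsupp : (∀ l ∈ (Finsupp.single (⟨i, hi⟩ : SallyIdx e 1 3) 1 +
      Finsupp.single (⟨j, hj⟩ : SallyIdx e 1 3) 1).support, a ≤ l.1) ↔ a ≤ i ∧ a ≤ j := by
    rw [Finsupp.support_add_eq_union]
    simp [or_imp, forall_and]
  rw [hs, hsupp]
  simp

lemma tailCoeffSum_mul_triple {e s a i j k : ℕ} (hi : i < e ∧ i ≠ 1 ∧ i ≠ 3)
    (hj : j < e ∧ j ≠ 1 ∧ j ≠ 3) (hk : k < e ∧ k ≠ 1 ∧ k ≠ 3)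
    (q : MvPolynomial (SallyIdx e 1 3) ℚ) :
    tailCoeffSum e s a (q * (sX e 1 3 i * sX e 1 3 j * sX e 1 3 k)) = 0 := by
  classical
  have hX : sX e 1 3 i * sX e 1 3 j * sX e 1 3 k =
      monomial (Finsupp.single ⟨i, hi⟩ 1 + Finsupp.single ⟨j, hj⟩ 1 +
        Finsupp.single ⟨k, hk⟩ 1) 1 := by
    rw [sX_of_mem hi, sX_of_mem hj, sX_of_mem hk, X, X, X, monomial_mul, monomial_mul, one_mul,
      one_mul]
  rw [hX, tailCoeffSum, quadraticCoeffSum_mul_monomial _ (by simp), quadraticCoeffSum_monomial,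
    if_neg (by simp), mul_zero]

/-- The index pairs `a ≤ b` for which `x_a x_b` is the term with larger smallest index in a
generator. -/
def IsGenPair (e a b : ℕ) : Prop :=
  2 ≤ a ∧ a ≤ b ∧ b < e ∧ a ≠ 3 ∧ b ≠ 3 ∧ ¬(b = e - 1 ∧ a ≤ 4)

/-- The element of `genSet e` one of whose terms is `x_a x_b`, the other one preceding it. -/
noncomputable def pairGen (e a b : ℕ) : MvPolynomial (SallyIdx e 1 3) ℚ :=
  if a = 2 then
    if b = e - 2 then sX e 1 3 0 ^ 3 - sX e 1 3 2 * sX e 1 3 (e - 2)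
    else sX e 1 3 0 * sX e 1 3 (b + 2) - sX e 1 3 2 * sX e 1 3 b
  else if a = 4 then
    if b = e - 2 then sX e 1 3 0 ^ 2 * sX e 1 3 2 - sX e 1 3 4 * sX e 1 3 (e - 2)
    else sX e 1 3 4 * sX e 1 3 b - sX e 1 3 2 * sX e 1 3 (b + 2)
  else
    if b = e - 1 then sX e 1 3 0 ^ 2 * sX e 1 3 (a - 1) - sX e 1 3 a * sX e 1 3 (e - 1)
    else sX e 1 3 (a - 1) * sX e 1 3 (b + 1) - sX e 1 3 a * sX e 1 3 b

lemma exists_eq_pairGen {e : ℕ} (he : 10 ≤ e) {p : MvPolynomial (SallyIdx e 1 3) ℚ}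
    (hp : p ∈ genSet e) : ∃ a b, IsGenPair e a b ∧ p = pairGen e a b := by
  unfold IsGenPair pairGen
  obtain (((((⟨i, j, hi, hij, hj, rfl⟩ | ⟨i, hi, hj, rfl⟩) | ⟨i, hi, rfl⟩) | rfl) |
    ⟨i, hi, rfl⟩) | rfl) := hp
  · refine ⟨i + 1, j, by omega, ?_⟩
    rw [if_neg (by omega), if_neg (by omega), if_neg (by omega), Nat.add_sub_cancel]
  · refine ⟨i + 1, e - 1, by omega, ?_⟩
    rw [if_neg (by omega), if_neg (by omega), if_pos rfl, Nat.add_sub_cancel]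
  · refine ⟨2, i, by omega, ?_⟩
    rw [if_pos rfl, if_neg (by omega)]
  · exact ⟨2, e - 2, by omega, by rw [if_pos rfl, if_pos rfl]⟩
  · refine ⟨4, 4 + i, by omega, ?_⟩
    rw [if_neg (by omega), if_pos rfl, if_neg (by omega), show 4 + i + 2 = 6 + i by omega]
  · exact ⟨4, e - 2, by omega, by rw [if_neg (by omega), if_pos rfl, if_pos rfl]⟩

lemma tailCoeffSum_mul_pairGen {e a b c d : ℕ} (he : 10 ≤ e) (hcd : IsGenPair e c d)
    (hab : IsGenPair e a b) (hne : ¬(c = a ∧ d = b)) (q : MvPolynomial (SallyIdx e 1 3) ℚ) :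
    tailCoeffSum e (a + b) a (q * pairGen e c d) = 0 := by
  unfold IsGenPair at hcd hab
  unfold pairGen
  split_ifs <;> simp only [pow_three', pow_two, mul_sub, map_sub]
  all_goals
    repeat rw [tailCoeffSum_mul_triple (by omega) (by omega) (by omega)]
    repeat rw [tailCoeffSum_mul_pair (by omega) (by omega)]
  all_goals split_ifs <;> first | omega | simp

lemma tailCoeffSum_pairGen_ne_zero {e a b : ℕ} (he : 10 ≤ e) (hab : IsGenPair e a b) :
    tailCoeffSum e (a + b) a (pairGen e a b) ≠ 0 := by
  unfold IsGenPair at hab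
  rw [← one_mul (pairGen e a b)]
  unfold pairGen
  split_ifs <;> simp only [pow_three', pow_two, mul_sub, map_sub]
  all_goals
    repeat rw [tailCoeffSum_mul_triple (by omega) (by omega) (by omega)]
    repeat rw [tailCoeffSum_mul_pair (by omega) (by omega)]
  all_goals split_ifs <;> first | omega | simp

end Minimality

theorem stmt1 (e : ℕ) (he : 10 ≤ e) :
    Ideal.span (genSet e) = sallyIdeal e 1 3 ∧
    ∀ G' : Set (MvPolynomial (SallyIdx e 1 3) ℚ), G' ⊂ genSet e →
      Ideal.span G' ≠ sallyIdeal e 1 3 := by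
  refine ⟨le_antisymm (span_genSet_le e he) (sallyIdeal_le_span_genSet e he), ?_⟩
  intro G' hG' hspan
  obtain ⟨f, hf, hfG'⟩ := Set.exists_of_ssubset hG'
  obtain ⟨a, b, hab, rfl⟩ := exists_eq_pairGen he hf
  have hmem : pairGen e a b ∈ Ideal.span G' :=
    hspan ▸ span_genSet_le e he (Ideal.subset_span hf)
  have hzero : ∀ p ∈ Ideal.span G', ∀ q, tailCoeffSum e (a + b) a (q * p) = 0 := by
    intro p hp
    induction hp using Submodule.span_induction with
    | mem g hg =>
      obtain ⟨c, d, hcd, rfl⟩ := exists_eq_pairGen he (hG'.1 hg)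
      refine tailCoeffSum_mul_pairGen he hcd hab ?_
      rintro ⟨rfl, rfl⟩
      exact hfG' hg
    | zero => simp
    | add p₁ p₂ _ _ h₁ h₂ => intro q; rw [mul_add, map_add, h₁, h₂, add_zero]
    | smul r p _ h => intro q; rw [smul_eq_mul, ← mul_assoc, h]
  exact tailCoeffSum_pairGen_ne_zero he hab (by simpa using hzero _ hmem 1)
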